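/- Let K ⊂ ℝ^N be a convex body with inradius r_K (the largest radius of a closed ball contained in K). If there is a unique point I_K ∈ K with B(I_K, r_K) ⊆ K (the incenter is unique), then I_K belongs to the heart ♥(K). -/

import Mathlib

open MeasureTheory Set Metric
open scoped RealInnerProductSpace ENNReal NNReal

noncomputable section

/-- Reflection of `x` across the hyperplane `{z : ⟪z, ω⟫ = l}` (for a unit vector `ω`). -/
def reflectH {N : ℕ} (l : ℝ) (ω x : EuclideanSpace ℝ (Fin N)) : EuclideanSpace ℝ (Fin N) :=
  x + (2 * (l - ⟪x, ω⟫)) • ω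

/-- The maximal folding function of a set `K`:
`R_K(ω) = inf {l : the reflection of K ∩ {⟪·,ω⟫ ≥ l} across {⟪·,ω⟫ = l} lies in K}`. -/
def foldingFn {N : ℕ} (K : Set (EuclideanSpace ℝ (Fin N))) (ω : EuclideanSpace ℝ (Fin N)) : ℝ :=
  sInf {l : ℝ | reflectH l ω '' {x ∈ K | l ≤ ⟪x, ω⟫} ⊆ K}

/-- The heart of a set `K`. -/
def heart {N : ℕ} (K : Set (EuclideanSpace ℝ (Fin N))) : Set (EuclideanSpace ℝ (Fin N)) :=
  {x ∈ K | ∀ ω : EuclideanSpace ℝ (Fin N), ‖ω‖ = 1 → ⟪x, ω⟫ ≤ foldingFn K ω}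

lemma inner_reflectH {N : ℕ} {ω : EuclideanSpace ℝ (Fin N)} (hω : ‖ω‖ = 1) (l : ℝ)
    (x : EuclideanSpace ℝ (Fin N)) : ⟪reflectH l ω x, ω⟫ = 2 * l - ⟪x, ω⟫ := by
  rw [reflectH, inner_add_left, real_inner_smul_left, real_inner_self_eq_norm_sq, hω]
  ring

lemma reflectH_reflectH {N : ℕ} {ω : EuclideanSpace ℝ (Fin N)} (hω : ‖ω‖ = 1) (l : ℝ)
    (x : EuclideanSpace ℝ (Fin N)) : reflectH l ω (reflectH l ω x) = x := by
  rw [reflectH, inner_reflectH hω, reflectH]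
  module

lemma dist_reflectH_sq {N : ℕ} {ω : EuclideanSpace ℝ (Fin N)} (hω : ‖ω‖ = 1) (l : ℝ)
    (x y : EuclideanSpace ℝ (Fin N)) :
    dist x (reflectH l ω y) ^ 2 = dist x y ^ 2 + 4 * (l - ⟪x, ω⟫) * (l - ⟪y, ω⟫) := by
  have h : x - reflectH l ω y = (x - y) - (2 * (l - ⟪y, ω⟫)) • ω := by
    rw [reflectH]
    module
  rw [dist_eq_norm, dist_eq_norm, h, norm_sub_sq_real, norm_smul, real_inner_smul_right,
    inner_sub_left, hω, Real.norm_eq_abs, mul_one, sq_abs]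
  ring

lemma dist_reflectH_comm {N : ℕ} {ω : EuclideanSpace ℝ (Fin N)} (hω : ‖ω‖ = 1) (l : ℝ)
    (x y : EuclideanSpace ℝ (Fin N)) :
    dist (reflectH l ω x) y = dist x (reflectH l ω y) := by
  rw [← sq_eq_sq₀ dist_nonneg dist_nonneg, dist_comm _ y, dist_reflectH_sq hω,
    dist_reflectH_sq hω, dist_comm y x]
  ring

/-- If the fold of `K` across `{⟪·, ω⟫ = l}` stays in `K`, then a ball in `K` centred in
`{l ≤ ⟪·, ω⟫}` has its mirror image in `K`. -/
lemma closedBall_reflectH_subset {N : ℕ} {K : Set (EuclideanSpace ℝ (Fin N))}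
    {ω : EuclideanSpace ℝ (Fin N)} (hω : ‖ω‖ = 1) {l r : ℝ} {c : EuclideanSpace ℝ (Fin N)}
    (hfold : reflectH l ω '' {x ∈ K | l ≤ ⟪x, ω⟫} ⊆ K)
    (hball : closedBall c r ⊆ K) (hc : l ≤ ⟪c, ω⟫) :
    closedBall (reflectH l ω c) r ⊆ K := by
  intro y hy
  rw [mem_closedBall] at hy
  rcases le_total l ⟪y, ω⟫ with h | h
  · refine hball (mem_closedBall.2 (le_trans ?_ hy))
    rw [← sq_le_sq₀ dist_nonneg dist_nonneg, dist_reflectH_sq hω]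
    nlinarith [mul_nonneg (sub_nonneg.2 h) (sub_nonneg.2 hc)]
  · refine hfold ⟨reflectH l ω y, ⟨hball ?_, ?_⟩, reflectH_reflectH hω l y⟩
    · rwa [mem_closedBall, dist_reflectH_comm hω]
    · rw [inner_reflectH hω]
      linarith

/-- For a bounded set, the set defining the folding function is nonempty. -/
lemma exists_reflectH_image_subset {N : ℕ} {K : Set (EuclideanSpace ℝ (Fin N))}
    (hK : Bornology.IsBounded K) {ω : EuclideanSpace ℝ (Fin N)} (hω : ‖ω‖ = 1) :
    ∃ l : ℝ, reflectH l ω '' {x ∈ K | l ≤ ⟪x, ω⟫} ⊆ K := by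
  obtain ⟨C, hC⟩ := hK.exists_norm_le
  refine ⟨C + 1, ?_⟩
  rintro _ ⟨x, ⟨hx, hl⟩, rfl⟩
  have h := real_inner_le_norm x ω
  rw [hω, mul_one] at h
  linarith [hC x hx]

/-- If the incenter of a convex body is unique, then it belongs to the heart. -/
theorem statement6 {N : ℕ} (K : Set (EuclideanSpace ℝ (Fin N)))
    (hKcpt : IsCompact K) (hKconv : Convex ℝ K) (hKint : (interior K).Nonempty)
    (I : EuclideanSpace ℝ (Fin N)) (r : ℝ)
    (hball : closedBall I r ⊆ K)
    (hrad : ∀ (x : EuclideanSpace ℝ (Fin N)) (ρ : ℝ), closedBall x ρ ⊆ K → ρ ≤ r)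
    (huniq : ∀ x : EuclideanSpace ℝ (Fin N), closedBall x r ⊆ K → x = I) :
    I ∈ heart K := by
  have hr : 0 ≤ r := by
    obtain ⟨x, hx⟩ := hKint
    obtain ⟨ε, hε, hsub⟩ := nhds_basis_closedBall.mem_iff.1 (mem_interior_iff_mem_nhds.1 hx)
    exact hε.le.trans (hrad x ε hsub)
  refine ⟨hball (mem_closedBall_self hr), fun ω hω => ?_⟩
  refine le_csInf (exists_reflectH_image_subset hKcpt.isBounded hω) fun l hl => ?_
  by_contra! hlt
  have hfix := huniq _ (closedBall_reflectH_subset hω hl hball hlt.le)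
  have h := inner_reflectH hω l I
  rw [hfix] at h
  linarith
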